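/- arXiv:2203.11555 — 3 statements merged into one kernel-verified Lean document; each statement's English description precedes it below -/
import Mathlib

section
/- Let x, y, v, q ∈ ℝ with q ≥ 2, and suppose v is a subgradient of g at x, i.e. g(z) ≥ g(x) + v·(z − x) for all z ∈ ℝ. Then 2·W(y) ≥ 2·W(x) + (v − 2x)·(y − x) − (q/2)·(y − x)². (This is the inequality showing that the double-well potential W is primal lower nice.) -/
/-- The non-smooth double-well potential. -/
noncomputable def W (η : ℝ) : ℝ :=
  if η ≤ -1 then -η - 1 else if η < 1 then (1 - η ^ 2) / 2 else η - 1

/-- The convex part `g` of the decomposition `2W(η) = g(η) − η²`. -/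
noncomputable def g (η : ℝ) : ℝ :=
  if η ≤ -1 then η ^ 2 - 2 * η - 2 else if η < 1 then 1 else η ^ 2 + 2 * η - 2

theorem two_mul_W_eq (η : ℝ) : 2 * W η = g η - η ^ 2 := by
  unfold W g
  split_ifs <;> ring

theorem double_well_primal_lower_nice (x y v q : ℝ) (hq : 2 ≤ q)
    (hv : ∀ z : ℝ, g x + v * (z - x) ≤ g z) :
    2 * W x + (v - 2 * x) * (y - x) - (q / 2) * (y - x) ^ 2 ≤ 2 * W y := by
  rw [two_mul_W_eq, two_mul_W_eq]
  nlinarith [hv y, mul_nonneg (sub_nonneg.2 hq) (sq_nonneg (y - x))]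
end

section
/- Fix ε > 0 and for t ≥ 0 define the scalar double-well flow map φ_t : ℝ → ℝ by: φ_t(c) = min{c + t/ε, −1} if c < −1; φ_t(c) = max{exp(t/ε)·c, −1} if c ∈ [−1, 0); φ_t(0) = 0; φ_t(c) = min{exp(t/ε)·c, 1} if c ∈ (0, 1]; φ_t(c) = max{c − t/ε, 1} if c > 1. Then for all c, d ∈ ℝ and all t ≥ 0, |φ_t(c) − φ_t(d)| ≤ exp(t/ε)·|c − d|; consequently the componentwise map on ℝⁿ satisfies ‖φ_t(x) − φ_t(y)‖₂ ≤ exp(t/ε)·‖x − y‖₂. -/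
/-- The Euclidean norm on `ℝⁿ`. -/
noncomputable def l2norm {n : ℕ} (x : Fin n → ℝ) : ℝ := Real.sqrt (∑ i, (x i) ^ 2)

/-- The time-`t` solution map of the scalar double-well subgradient flow
`dξ/dt ∈ −ε⁻¹∂W(ξ)`. -/
noncomputable def phi (ε t c : ℝ) : ℝ :=
  if c < -1 then min (c + t / ε) (-1)
  else if c < 0 then max (Real.exp (t / ε) * c) (-1)
  else if c = 0 then 0
  else if c ≤ 1 then min (Real.exp (t / ε) * c) 1
  else max (c - t / ε) 1

theorem abs_phi_sub_phi_le_of_le {ε t c d : ℝ} (hs : 0 ≤ t / ε) (hcd : c ≤ d) :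
    |phi ε t c - phi ε t d| ≤ Real.exp (t / ε) * |c - d| := by
  have hE : 1 ≤ Real.exp (t / ε) := Real.one_le_exp hs
  unfold phi
  generalize Real.exp (t / ε) = E at *
  generalize t / ε = s at *
  have h_sub : d - c ≤ E * d - E * c := by nlinarith
  have hc_neg : c < 0 → E * c ≤ c := fun h => by nlinarith
  have hc_pos : 0 ≤ c → c ≤ E * c := fun h => by nlinarith
  have hd_neg : d < 0 → E * d ≤ d := fun h => by nlinarith
  have hd_pos : 0 ≤ d → d ≤ E * d := fun h => by nlinarith
  rw [abs_of_nonpos (sub_nonpos.2 hcd), abs_le,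
    show E * -(c - d) = E * d - E * c by ring]
  have hc_zero : c = 0 → E * c = 0 := fun h => by simp [h]
  have hd_zero : d = 0 → E * d = 0 := fun h => by simp [h]
  generalize E * c = p at *
  generalize E * d = q at *
  clear hE
  grind (splits := 20)

theorem abs_phi_sub_phi_le {ε t : ℝ} (hs : 0 ≤ t / ε) (c d : ℝ) :
    |phi ε t c - phi ε t d| ≤ Real.exp (t / ε) * |c - d| := by
  rcases le_total c d with h | h
  · exact abs_phi_sub_phi_le_of_le hs h
  · rw [abs_sub_comm, abs_sub_comm c]
    exact abs_phi_sub_phi_le_of_le hs h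

theorem l2norm_le_mul_l2norm {n : ℕ} {K : ℝ} (hK : 0 ≤ K) {u v : Fin n → ℝ}
    (h : ∀ i, |u i| ≤ K * |v i|) : l2norm u ≤ K * l2norm v := by
  unfold l2norm
  refine Real.sqrt_le_iff.2 ⟨by positivity, ?_⟩
  rw [mul_pow, Real.sq_sqrt (by positivity), Finset.mul_sum]
  refine Finset.sum_le_sum fun i _ => ?_
  rw [← sq_abs (u i), ← sq_abs (v i), ← mul_pow]
  gcongr
  exact h i

theorem double_well_flow_expansion_bound (ε : ℝ) (hε : 0 < ε) :
    (∀ c d t : ℝ, 0 ≤ t → |phi ε t c - phi ε t d| ≤ Real.exp (t / ε) * |c - d|) ∧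
    (∀ n : ℕ, ∀ x y : Fin n → ℝ, ∀ t : ℝ, 0 ≤ t →
      l2norm (fun i => phi ε t (x i) - phi ε t (y i)) ≤
        Real.exp (t / ε) * l2norm (x - y)) := by
  refine ⟨fun c d t ht => abs_phi_sub_phi_le (div_nonneg ht hε.le) c d, fun n x y t ht => ?_⟩
  exact l2norm_le_mul_l2norm (Real.exp_pos _).le fun i =>
    abs_phi_sub_phi_le (div_nonneg ht hε.le) (x i) (y i)
end

section
/- Let A be a real m×n matrix with rank(A) = n, b ∈ ℝᵐ, and let θ* be the unique global minimiser of Φ̄(θ) := ½‖Aθ − b‖₂² + ‖θ‖₁. Suppose ζ : [0, ∞) → ℝⁿ is locally Lipschitz continuous and that for almost every t ≥ 0, ζ is differentiable at t and there exists g(t) ∈ ℝⁿ with g(t)ᵢ ∈ G(ζ(t)ᵢ) for all i such that ζ′(t) = −½(AᵀAζ(t) − Aᵀb) − ½g(t). Then ζ(t) → θ* as t → ∞; i.e. the sparse inversion subgradient flow converges to the stationary point of Φ̄. -/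
open Matrix

/-- The subdifferential of the absolute value: `G(θ') = {1}` if `θ' > 0`, `{−1}` if `θ' < 0`,
and `[−1,1]` if `θ' = 0`. -/
def G (u : ℝ) : Set ℝ := if 0 < u then {1} else if u < 0 then {-1} else Set.Icc (-1) 1

/-- The LASSO-type target `Φ̄(θ) = ½‖Aθ − b‖₂² + ‖θ‖₁`. -/
noncomputable def Phibar {m n : ℕ} (A : Matrix (Fin m) (Fin n) ℝ) (b : Fin m → ℝ)
    (θ : Fin n → ℝ) : ℝ :=
  (1 / 2) * ∑ j, ((A *ᵥ θ) j - b j) ^ 2 + ∑ i, |θ i|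

open MeasureTheory Set Filter

/-- Elements of `G u` are subgradients of the absolute value at `u`. -/
lemma mul_sub_le_of_mem_G {g u : ℝ} (hg : g ∈ G u) (v : ℝ) : g * (v - u) ≤ |v| - |u| := by
  unfold G at hg
  split_ifs at hg with hpos hneg
  · rw [mem_singleton_iff.1 hg, abs_of_pos hpos]
    linarith [le_abs_self v]
  · rw [mem_singleton_iff.1 hg, abs_of_neg hneg]
    linarith [neg_abs_le v]
  · obtain rfl : u = 0 := le_antisymm (not_lt.1 hpos) (not_lt.1 hneg)
    rw [abs_zero, sub_zero, sub_zero]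
    calc g * v ≤ |g * v| := le_abs_self _
      _ = |g| * |v| := abs_mul _ _
      _ ≤ 1 * |v| := by gcongr; exact abs_le.2 hg
      _ = |v| := one_mul _

/-- Strong convexity of `Phibar`, combined with minimality, at a point with subgradient `g`. -/
lemma half_sum_sq_mulVec_sub_le {m n : ℕ} (A : Matrix (Fin m) (Fin n) ℝ) (b : Fin m → ℝ)
    {θs z g : Fin n → ℝ} (hmin : Phibar A b θs ≤ Phibar A b z) (hg : ∀ i, g i ∈ G (z i)) :
    (1 / 2) * ∑ j, ((A *ᵥ (z - θs)) j) ^ 2 ≤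
      ∑ i, (z i - θs i) * (((Aᵀ * A) *ᵥ z - Aᵀ *ᵥ b) i + g i) := by
  have hsub : ∑ i, g i * (θs i - z i) ≤ ∑ i, |θs i| - ∑ i, |z i| := by
    rw [← Finset.sum_sub_distrib]
    exact Finset.sum_le_sum fun i _ => mul_sub_le_of_mem_G (hg i) _
  have hdual : ∑ i, (z i - θs i) * ((Aᵀ * A) *ᵥ z - Aᵀ *ᵥ b) i =
      ∑ j, (A *ᵥ (z - θs)) j * ((A *ᵥ z) j - b j) := by
    have : (z - θs) ⬝ᵥ ((Aᵀ * A) *ᵥ z - Aᵀ *ᵥ b) = (A *ᵥ (z - θs)) ⬝ᵥ (A *ᵥ z - b) := by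
      rw [← mulVec_mulVec, ← mulVec_sub, dotProduct_mulVec, vecMul_transpose]
    simpa only [dotProduct, Pi.sub_apply] using this
  have hquad : ∑ j, ((A *ᵥ θs) j - b j) ^ 2 = ∑ j, ((A *ᵥ z) j - b j) ^ 2
      - 2 * ∑ j, (A *ᵥ (z - θs)) j * ((A *ᵥ z) j - b j) + ∑ j, ((A *ᵥ (z - θs)) j) ^ 2 := by
    rw [Finset.mul_sum, ← Finset.sum_sub_distrib, ← Finset.sum_add_distrib]
    refine Finset.sum_congr rfl fun j _ => ?_
    rw [mulVec_sub, Pi.sub_apply]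
    ring
  have hneg : ∑ i, (z i - θs i) * g i = -∑ i, g i * (θs i - z i) := by
    rw [← Finset.sum_neg_distrib]
    exact Finset.sum_congr rfl fun i _ => by ring
  simp only [mul_add, Finset.sum_add_distrib]
  rw [hdual, hneg]
  unfold Phibar at hmin
  linarith

lemma mulVecLin_ker_eq_bot_of_rank_eq {m n : ℕ} (A : Matrix (Fin m) (Fin n) ℝ)
    (hA : A.rank = n) : LinearMap.ker A.mulVecLin = ⊥ := by
  have h := A.mulVecLin.finrank_range_add_finrank_ker
  rw [Module.finrank_fin_fun] at h
  have hr : Module.finrank ℝ (LinearMap.range A.mulVecLin) = n := hA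
  exact Submodule.finrank_eq_zero.1 (by omega)

/-- A full column rank matrix is bounded below. -/
lemma exists_pos_mul_sum_sq_le {m n : ℕ} (A : Matrix (Fin m) (Fin n) ℝ) (hA : A.rank = n) :
    ∃ c : ℝ, 0 < c ∧ ∀ d : Fin n → ℝ,
      c * ∑ i, d i ^ 2 ≤ (1 / 2) * ∑ j, ((A *ᵥ d) j) ^ 2 := by
  obtain ⟨K, -, hK⟩ :=
    A.mulVecLin.exists_antilipschitzWith (mulVecLin_ker_eq_bot_of_rank_eq A hA)
  have hbound (d : Fin n → ℝ) :
      ∑ i, d i ^ 2 ≤ (n * (K : ℝ) ^ 2 + 1) * ∑ j, ((A *ᵥ d) j) ^ 2 := by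
    have hsum : 0 ≤ ∑ j, ((A *ᵥ d) j) ^ 2 := Finset.sum_nonneg fun j _ => sq_nonneg _
    have hd : ‖d‖ ≤ K * ‖A *ᵥ d‖ := by
      simpa using hK.le_mul_dist d 0
    have hAd : ‖A *ᵥ d‖ ≤ √(∑ j, ((A *ᵥ d) j) ^ 2) := by
      refine (pi_norm_le_iff_of_nonneg (Real.sqrt_nonneg _)).2 fun j => ?_
      exact Real.abs_le_sqrt (Finset.single_le_sum (f := fun j => ((A *ᵥ d) j) ^ 2)
        (fun j _ => sq_nonneg _) (Finset.mem_univ j))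
    have hsq : ‖d‖ ^ 2 ≤ (K : ℝ) ^ 2 * ∑ j, ((A *ᵥ d) j) ^ 2 := by
      calc ‖d‖ ^ 2 ≤ (K * √(∑ j, ((A *ᵥ d) j) ^ 2)) ^ 2 := by
            gcongr
            exact hd.trans (by gcongr)
        _ = _ := by rw [mul_pow, Real.sq_sqrt hsum]
    calc ∑ i, d i ^ 2 ≤ ∑ _i : Fin n, ‖d‖ ^ 2 := by
          refine Finset.sum_le_sum fun i _ => ?_
          exact sq_le_sq.2 (by simpa using norm_le_pi_norm d i)
      _ = n * ‖d‖ ^ 2 := by simp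
      _ ≤ n * ((K : ℝ) ^ 2 * ∑ j, ((A *ᵥ d) j) ^ 2) := by gcongr
      _ ≤ _ := by linarith
  have hpos : (0 : ℝ) < n * (K : ℝ) ^ 2 + 1 := by positivity
  refine ⟨1 / (2 * (n * (K : ℝ) ^ 2 + 1)), by positivity, fun d => ?_⟩
  rw [div_mul_eq_mul_div, div_le_iff₀ (by positivity)]
  linarith [hbound d]

/-- A locally Lipschitz function whose derivative is nonpositive almost everywhere on `[0, ∞)`
stays below its initial value. -/
lemma LocallyLipschitz.le_of_ae_hasDerivAt_nonpos {f : ℝ → ℝ} (hf : LocallyLipschitz f)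
    (hderiv : ∀ᵐ t ∂(volume.restrict (Ici (0 : ℝ))), ∃ f', f' ≤ 0 ∧ HasDerivAt f f' t)
    {t : ℝ} (ht : 0 ≤ t) : f t ≤ f 0 := by
  obtain ⟨K, hK⟩ := (hf.locallyLipschitzOn (s := uIcc 0 t)).exists_lipschitzOnWith_of_compact
    isCompact_uIcc
  have hint := hK.absolutelyContinuousOnInterval.integral_deriv_eq_sub
  have hnonpos : ∫ x in (0 : ℝ)..t, deriv f x ≤ 0 := by
    rw [intervalIntegral.integral_of_le ht]
    refine integral_nonpos_of_ae ?_
    have hsubset : Ioc 0 t ⊆ Ici (0 : ℝ) := fun x hx => hx.1.le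
    filter_upwards [ae_restrict_of_ae_restrict_of_subset hsubset hderiv] with x hx
    obtain ⟨f', hf', hd⟩ := hx
    simpa [hd.deriv] using hf'
  linarith

theorem sparse_inversion_flow_converges {m n : ℕ} (A : Matrix (Fin m) (Fin n) ℝ)
    (hA : A.rank = n) (b : Fin m → ℝ) (θs : Fin n → ℝ)
    (hmin : ∀ θ : Fin n → ℝ, Phibar A b θs ≤ Phibar A b θ)
    (huniq : ∀ θ' : Fin n → ℝ, (∀ θ, Phibar A b θ' ≤ Phibar A b θ) → θ' = θs)
    (ζ : ℝ → Fin n → ℝ) (hLip : LocallyLipschitz ζ)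
    (hflow : ∀ᵐ t ∂(MeasureTheory.volume.restrict (Set.Ici (0 : ℝ))),
      ∃ g : Fin n → ℝ, (∀ i, g i ∈ G (ζ t i)) ∧
        HasDerivAt ζ (-((1 : ℝ) / 2) • ((Aᵀ * A) *ᵥ ζ t - Aᵀ *ᵥ b) - ((1 : ℝ) / 2) • g) t) :
    Filter.Tendsto ζ Filter.atTop (nhds θs) := by
  obtain ⟨c, hc, hcoer⟩ := exists_pos_mul_sum_sq_le A hA
  have hWlip : LocallyLipschitz fun t => Real.exp (c * t) * ∑ i, (ζ t i - θs i) ^ 2 := by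
    have hsmooth : ContDiff ℝ 1 fun p : ℝ × (Fin n → ℝ) =>
        Real.exp (c * p.1) * ∑ i, (p.2 i - θs i) ^ 2 := by fun_prop
    exact hsmooth.locallyLipschitz.comp (LocallyLipschitz.id.prodMk hLip)
  have hWderiv : ∀ᵐ t ∂(volume.restrict (Ici (0 : ℝ))), ∃ w ≤ 0,
      HasDerivAt (fun t => Real.exp (c * t) * ∑ i, (ζ t i - θs i) ^ 2) w t := by
    filter_upwards [hflow] with t ht
    obtain ⟨g, hg, hd⟩ := ht
    have hV := HasDerivAt.fun_sum fun i (_ : i ∈ Finset.univ) =>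
      ((hasDerivAt_pi.1 hd i).sub_const (θs i)).fun_pow 2
    have hE : HasDerivAt (fun t => Real.exp (c * t)) (Real.exp (c * t) * c) t := by
      simpa using ((hasDerivAt_id t).const_mul c).exp
    refine ⟨_, ?_, hE.mul hV⟩
    have hdiss := half_sum_sq_mulVec_sub_le A b (hmin (ζ t)) hg
    have hdecay : c * ∑ i, (ζ t i - θs i) ^ 2 ≤ _ := (hcoer (ζ t - θs)).trans hdiss
    rw [mul_assoc, ← mul_add]
    refine mul_nonpos_of_nonneg_of_nonpos (Real.exp_pos _).le ?_
    refine (add_le_add_left hdecay _).trans_eq ?_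
    rw [← Finset.sum_add_distrib]
    refine Finset.sum_eq_zero fun i _ => ?_
    simp only [Pi.sub_apply, Pi.smul_apply, smul_eq_mul]
    push_cast
    ring
  have hV : ∀ t, 0 ≤ t → ∑ i, (ζ t i - θs i) ^ 2 ≤
      Real.exp (-(c * t)) * ∑ i, (ζ 0 i - θs i) ^ 2 := by
    intro t ht
    have h := hWlip.le_of_ae_hasDerivAt_nonpos hWderiv ht
    simp only [mul_zero, Real.exp_zero, one_mul] at h
    calc ∑ i, (ζ t i - θs i) ^ 2
        = Real.exp (-(c * t)) * (Real.exp (c * t) * ∑ i, (ζ t i - θs i) ^ 2) := by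
          rw [← mul_assoc, ← Real.exp_add, neg_add_cancel, Real.exp_zero, one_mul]
      _ ≤ _ := by gcongr
  have hexp : Tendsto (fun t => Real.exp (-(c * t)) * ∑ i, (ζ 0 i - θs i) ^ 2) atTop
      (nhds 0) := by
    simpa using (Real.tendsto_exp_neg_atTop_nhds_zero.comp
      (tendsto_id.const_mul_atTop hc)).mul_const (∑ i, (ζ 0 i - θs i) ^ 2)
  refine tendsto_pi_nhds.2 fun i => ?_
  have hsq : Tendsto (fun t => (ζ t i - θs i) ^ 2) atTop (nhds 0) := by
    refine squeeze_zero' (Eventually.of_forall fun t => sq_nonneg _) ?_ hexp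
    filter_upwards [eventually_ge_atTop 0] with t ht
    exact (Finset.single_le_sum (f := fun i => (ζ t i - θs i) ^ 2)
      (fun i _ => sq_nonneg _) (Finset.mem_univ i)).trans (hV t ht)
  have habs : Tendsto (fun t => |ζ t i - θs i|) atTop (nhds 0) := by
    simpa [Real.sqrt_sq_eq_abs] using hsq.sqrt
  exact tendsto_iff_dist_tendsto_zero.2 habs
end
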